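/- If G ⊃ A_r ⊑_p P, then I*_i(P, G) ≤_Ω I*_i(P, A_r), where I* = ⨆_n Tⁿ(I_⊥) is the least fixed point of T. -/

import Mathlib

set_option maxHeartbeats 1000000

/-! ## Syntax of UCTT / HOHH -/

/-- Simple types of Church's theory: individuals, propositions, arrow types. -/
inductive Ty : Type
  | iota : Ty
  | o : Ty
  | arr : Ty → Ty → Ty
  deriving DecidableEq

/-- Free (logic) variables: carry an identifier, a level and a type. -/
structure Vr : Type where
  name : ℕ
  lvl : ℕ
  ty : Ty
  deriving DecidableEq

/-- Constants: carry an identifier, a level and a type. -/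
structure Cs : Type where
  name : ℕ
  lvl : ℕ
  ty : Ty
  deriving DecidableEq

/-- Simply typed λ-terms in (principal) normal form, with formulas (terms of
type `o`) represented by dedicated constructors for the logical constants
`⊤, ⊥, ∧, ∨, ⊃, Π (∀), Σ (∃)` in applied position.  Bound variables (`bvar`)
and free (logic) variables (`fvar`) are disjoint. -/
inductive Tm : Type
  | bvar : ℕ → Ty → Tm
  | fvar : Vr → Tm
  | cst : Cs → Tm
  | app : Tm → Tm → Tm
  | lam : ℕ → Ty → Tm → Tm
  | top : Tm
  | bot : Tm
  | conj : Tm → Tm → Tm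
  | disj : Tm → Tm → Tm
  | impl : Tm → Tm → Tm
  | all : ℕ → Ty → Tm → Tm
  | ex : ℕ → Ty → Tm → Tm
  deriving DecidableEq

namespace Tm

/-- Applying a map on free variables to a term.  Since bound and free
variables are disjoint, no capture can occur. -/
def subst (f : Vr → Tm) : Tm → Tm
  | bvar n a => bvar n a
  | fvar v => f v
  | cst c => cst c
  | app t u => app (subst f t) (subst f u)
  | lam n a t => lam n a (subst f t)
  | top => top
  | bot => bot
  | conj t u => conj (subst f t) (subst f u)
  | disj t u => disj (subst f t) (subst f u)
  | impl t u => impl (subst f t) (subst f u)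
  | all n a t => all n a (subst f t)
  | ex n a t => ex n a (subst f t)

/-- Instantiation `t[s/x]` of the bound variable `(x, a)` by the term `s`. -/
def inst (x : ℕ) (a : Ty) (s : Tm) : Tm → Tm
  | bvar n b => if n = x ∧ b = a then s else bvar n b
  | fvar v => fvar v
  | cst c => cst c
  | app t u => app (inst x a s t) (inst x a s u)
  | lam n b t => if n = x ∧ b = a then lam n b t else lam n b (inst x a s t)
  | top => top
  | bot => bot
  | conj t u => conj (inst x a s t) (inst x a s u)
  | disj t u => disj (inst x a s t) (inst x a s u)
  | impl t u => impl (inst x a s t) (inst x a s u)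
  | all n b t => if n = x ∧ b = a then all n b t else all n b (inst x a s t)
  | ex n b t => if n = x ∧ b = a then ex n b t else ex n b (inst x a s t)

/-- The level of a term: the maximum label of the constants and free
variables occurring in it. -/
def lvl : Tm → ℕ
  | bvar _ _ => 0
  | fvar v => v.lvl
  | cst c => c.lvl
  | app t u => max (lvl t) (lvl u)
  | lam _ _ t => lvl t
  | top => 0
  | bot => 0
  | conj t u => max (lvl t) (lvl u)
  | disj t u => max (lvl t) (lvl u)
  | impl t u => max (lvl t) (lvl u)
  | all _ _ t => lvl t
  | ex _ _ t => lvl t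

/-- The free variables of a term. -/
def fvars : Tm → Finset Vr
  | bvar _ _ => ∅
  | fvar v => {v}
  | cst _ => ∅
  | app t u => fvars t ∪ fvars u
  | lam _ _ t => fvars t
  | top => ∅
  | bot => ∅
  | conj t u => fvars t ∪ fvars u
  | disj t u => fvars t ∪ fvars u
  | impl t u => fvars t ∪ fvars u
  | all _ _ t => fvars t
  | ex _ _ t => fvars t

/-- The constants occurring in a term. -/
def csts : Tm → Finset Cs
  | bvar _ _ => ∅
  | fvar _ => ∅
  | cst c => {c}
  | app t u => csts t ∪ csts u
  | lam _ _ t => csts t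
  | top => ∅
  | bot => ∅
  | conj t u => csts t ∪ csts u
  | disj t u => csts t ∪ csts u
  | impl t u => csts t ∪ csts u
  | all _ _ t => csts t
  | ex _ _ t => csts t

/-- The canonical type of a term (meaningful on well-typed terms). -/
def tyOf : Tm → Ty
  | bvar _ a => a
  | fvar v => v.ty
  | cst c => c.ty
  | app t _ =>
      match tyOf t with
      | Ty.arr _ b => b
      | b => b
  | lam _ a t => Ty.arr a (tyOf t)
  | _ => Ty.o

/-- Well-typedness of a term. -/
def wt : Tm → Prop
  | bvar _ _ => True
  | fvar _ => True
  | cst _ => True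
  | app t u => wt t ∧ wt u ∧ ∃ b, tyOf t = Ty.arr (tyOf u) b
  | lam _ _ t => wt t
  | top => True
  | bot => True
  | conj t u => wt t ∧ wt u ∧ tyOf t = Ty.o ∧ tyOf u = Ty.o
  | disj t u => wt t ∧ wt u ∧ tyOf t = Ty.o ∧ tyOf u = Ty.o
  | impl t u => wt t ∧ wt u ∧ tyOf t = Ty.o ∧ tyOf u = Ty.o
  | all _ _ t => wt t ∧ tyOf t = Ty.o
  | ex _ _ t => wt t ∧ tyOf t = Ty.o

/-- Positive terms: terms not containing `⊥`, `⊃` or `∀`. -/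
def pos : Tm → Prop
  | bot => False
  | impl _ _ => False
  | all _ _ _ => False
  | app t u => pos t ∧ pos u
  | lam _ _ t => pos t
  | conj t u => pos t ∧ pos u
  | disj t u => pos t ∧ pos u
  | ex _ _ t => pos t
  | _ => True

/-- The head of an application spine. -/
def headTm : Tm → Tm
  | app t _ => headTm t
  | t => t

/-- Atomic formulas: terms (of type `o`) whose outermost constructor is not
a logical constant. -/
def isAtom : Tm → Prop
  | fvar _ => True
  | cst _ => True
  | app _ _ => True
  | _ => False

/-- An atomic formula is rigid when its head symbol is a constant. -/
def rigid (t : Tm) : Prop := ∃ c : Cs, t.headTm = cst c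

mutual
  /-- HOHH program formulas: `D ::= A_r | G ⊃ A_r | D ∧ D | ∀x.D`. -/
  inductive isProg : Tm → Prop
    | atom {t : Tm} : t.isAtom → t.rigid → isProg t
    | imp {g a : Tm} : isGoal g → a.isAtom → a.rigid → isProg (Tm.impl g a)
    | conj {d₁ d₂ : Tm} : isProg d₁ → isProg d₂ → isProg (Tm.conj d₁ d₂)
    | all {n : ℕ} {a : Ty} {d : Tm} : isProg d → isProg (Tm.all n a d)

  /-- HOHH goal formulas:
  `G ::= ⊤ | A | G ∨ G | G ∧ G | ∃x.G | D ⊃ G | ∀x.G`. -/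
  inductive isGoal : Tm → Prop
    | top : isGoal Tm.top
    | atom {t : Tm} : t.isAtom → isGoal t
    | conj {g₁ g₂ : Tm} : isGoal g₁ → isGoal g₂ → isGoal (Tm.conj g₁ g₂)
    | disj {g₁ g₂ : Tm} : isGoal g₁ → isGoal g₂ → isGoal (Tm.disj g₁ g₂)
    | ex {n : ℕ} {a : Ty} {g : Tm} : isGoal g → isGoal (Tm.ex n a g)
    | imp {d g : Tm} : isProg d → isGoal g → isGoal (Tm.impl d g)
    | all {n : ℕ} {a : Ty} {g : Tm} : isGoal g → isGoal (Tm.all n a g)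
end

/-- The elaboration of a program formula into its set of clauses. -/
def elabD : Tm → Set Tm
  | Tm.conj d₁ d₂ => elabD d₁ ∪ elabD d₂
  | Tm.all n a d => Tm.all n a '' elabD d
  | d => {d}

/-- Iterated universal quantification `∀x₁ … ∀xₙ. t`. -/
def alls : List (ℕ × Ty) → Tm → Tm
  | [], t => t
  | x :: xs, t => Tm.all x.1 x.2 (alls xs t)

/-- Simultaneous instantiation of a list of bound variables by a list of
terms (outermost binder first). -/
def instL : List (ℕ × Ty) → List Tm → Tm → Tm
  | x :: xs, s :: ss, t => instL xs ss (inst x.1 x.2 s t)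
  | _, _, t => t

end Tm

/-- The elaboration of a program (set of program formulas). -/
def elabProg (P : Finset Tm) : Set Tm := ⋃ D ∈ P, Tm.elabD D

/-! ## Substitutions -/

/-- Substitutions: finitely supported maps from free variables to terms. -/
structure Subst : Type where
  f : Vr → Tm
  fin : Set.Finite {v : Vr | f v ≠ Tm.fvar v}

namespace Subst

/-- The domain (support) of a substitution. -/
def dom (θ : Subst) : Set Vr := {v : Vr | θ.f v ≠ Tm.fvar v}

/-- The identity substitution. -/
protected def id : Subst :=
  ⟨fun v => Tm.fvar v, by
    have : {v : Vr | Tm.fvar v ≠ Tm.fvar v} = ∅ := by ext v; simp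
    rw [this]; exact Set.finite_empty⟩

/-- Composition of substitutions, in diagrammatic order. -/
def comp (σ τ : Subst) : Subst :=
  ⟨fun v => (σ.f v).subst τ.f, by
    apply Set.Finite.subset (σ.fin.union τ.fin)
    intro v hv
    simp only [Set.mem_setOf_eq] at hv
    by_contra h
    simp only [Set.mem_union, Set.mem_setOf_eq, not_or, not_not] at h
    apply hv
    rw [h.1]
    simp [Tm.subst, h.2]⟩

/-- Restriction of a substitution to a finite set of variables. -/
def restrict (σ : Subst) (S : Finset Vr) : Subst :=
  ⟨fun v => if v ∈ S then σ.f v else Tm.fvar v, by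
    apply Set.Finite.subset σ.fin
    intro v hv
    simp only [Set.mem_setOf_eq] at hv ⊢
    by_cases h : v ∈ S
    · simpa [h] using hv
    · simp [h] at hv⟩

/-- The substitution replacing the single variable `x` by the term `t`. -/
def single (x : Vr) (t : Tm) : Subst :=
  ⟨fun v => if v = x then t else Tm.fvar v, by
    apply Set.Finite.subset (Set.finite_singleton x)
    intro v hv
    simp only [Set.mem_setOf_eq] at hv
    by_cases h : v = x
    · simp [h]
    · simp [h] at hv⟩

/-- Legal substitutions: the range consists of positive well-typed terms,
types are preserved, and levels are preserved. -/
def legal (θ : Subst) : Prop :=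
  ∀ v : Vr, (θ.f v).pos ∧ (θ.f v).wt ∧ (θ.f v).tyOf = v.ty ∧ (θ.f v).lvl ≤ v.lvl

/-- Safe (idempotent) substitutions: the free variables of the range are
disjoint from the domain. -/
def safe (θ : Subst) : Prop :=
  ∀ v w : Vr, θ.f v ≠ Tm.fvar v → w ∈ (θ.f v).fvars → θ.f w = Tm.fvar w

/-- A substitution has level `≤ i` when every term in its range does. -/
def lvlLe (θ : Subst) (i : ℕ) : Prop :=
  ∀ v ∈ θ.dom, (θ.f v).lvl ≤ i

end Subst

/-! ## The term structure, extensions of programs, weak valuations and T -/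

/-- The extension `[i; D]` of a program formula `D` at level `i`: the set of
pairs `(A_rγ, Gγ)` (head, body) obtained by instantiating the outermost
universally quantified variables of a clause `∀x₁ … xₙ (G ⊃ A_r) ∈ elab(D)`
by positive terms of level `≤ i` of the appropriate types. -/
def extD (i : ℕ) (p : Tm) : Set (Tm × Tm) :=
  { q | ∃ (xs : List (ℕ × Ty)) (G A : Tm) (ts : List Tm),
      Tm.alls xs (Tm.impl G A) ∈ Tm.elabD p ∧
      List.Forall₂
        (fun (t : Tm) (x : ℕ × Ty) =>
          t.pos ∧ t.wt ∧ t.tyOf = x.2 ∧ t.lvl ≤ i) ts xs ∧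
      q = (Tm.instL xs ts A, Tm.instL xs ts G) }

/-- The extension `[i; P]` of a program `P` at level `i`. -/
def extP (i : ℕ) (P : Finset Tm) : Set (Tm × Tm) := ⋃ D ∈ P, extD i D

/-- The preorder `⊑ₚ` on (interpreted) programs of the term structure:
`P ⊑ₚ P'` iff `[i;P] ⊆ [i;P']` for every `i`. -/
def progLe (p q : Tm) : Prop := ∀ i : ℕ, extD i p ⊆ extD i q

/-- **Weak valuations** on the term structure, with `Ω = {⊤,⊥} = Prop`. -/
structure WeakVal : Type where
  I : ℕ → Tm → Tm → Prop
  monoP : ∀ {i : ℕ} {p q g : Tm}, progLe p q → I i p g → I i q g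
  monoL : ∀ {i j : ℕ} {p g : Tm}, i ≤ j → I i p g → I j p g
  vtop : ∀ (i : ℕ) (p : Tm), I i p Tm.top
  vconj : ∀ {i : ℕ} {p g₁ g₂ : Tm},
      I i p (Tm.conj g₁ g₂) → I i p g₁ ∧ I i p g₂
  vdisj : ∀ {i : ℕ} {p g₁ g₂ : Tm},
      I i p (Tm.disj g₁ g₂) → I i p g₁ ∨ I i p g₂
  vimpl : ∀ {i : ℕ} {p d g : Tm}, I i p (Tm.impl d g) → I i (Tm.conj p d) g
  vex : ∀ {i : ℕ} {p : Tm} {x : ℕ} {a : Ty} {g : Tm},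
      I i p (Tm.ex x a g) →
      ∃ t : Tm, t.pos ∧ t.wt ∧ t.tyOf = a ∧ t.lvl ≤ i ∧
        I i p (Tm.inst x a t g)
  vall : ∀ {i : ℕ} {p : Tm} {x : ℕ} {a : Ty} {g : Tm},
      I i p (Tm.all x a g) →
      ∀ c : Cs, c.lvl = i + 1 → c.ty = a →
        I (i + 1) p (Tm.inst x a (Tm.cst c) g)
  vinv : ∀ (i : ℕ) (p g : Tm) (x : Vr) (c c' : Cs),
      p.lvl ≤ i → g.lvl ≤ i →
      c.lvl = i + 1 → c'.lvl = i + 1 → c.ty = x.ty → c'.ty = x.ty →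
      (I (i + 1) (Tm.subst (Subst.single x (Tm.cst c)).f p)
          (Tm.subst (Subst.single x (Tm.cst c)).f g) ↔
        I (i + 1) (Tm.subst (Subst.single x (Tm.cst c')).f p)
          (Tm.subst (Subst.single x (Tm.cst c')).f g))

/-- The pointwise order on weak valuations. -/
def WeakVal.le (J K : WeakVal) : Prop := ∀ i p g, J.I i p g → K.I i p g

/-- The operator `T` on (the underlying data of) weak valuations. -/
def Tfun (I : ℕ → Tm → Tm → Prop) : ℕ → Tm → Tm → Prop := fun i p g =>
  match g with
  | Tm.top => True
  | Tm.conj g₁ g₂ => I i p g₁ ∧ I i p g₂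
  | Tm.disj g₁ g₂ => I i p g₁ ∨ I i p g₂
  | Tm.impl d g' => I i (Tm.conj p d) g'
  | Tm.ex x a g' =>
      ∃ t : Tm, t.pos ∧ t.wt ∧ t.tyOf = a ∧ t.lvl ≤ i ∧
        I i p (Tm.inst x a t g')
  | Tm.all x a g' =>
      ∀ c : Cs, c.lvl = i + 1 → c.ty = a → c ∉ p.csts ∪ g'.csts →
        I (i + 1) p (Tm.inst x a (Tm.cst c) g')
  | g => I i p g ∨ ∃ q ∈ extD i p, q.1 = g ∧ I i p q.2

/-- The least weak valuation `I_⊥`: `(I_⊥)_i(P,G) = ⊤` iff `G = ⊤`. -/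
def Ibot : ℕ → Tm → Tm → Prop := fun _ _ g => g = Tm.top

/-- The finite iterates `Tⁿ(I_⊥)` of `T` on the least weak valuation. -/
def Titer : ℕ → ℕ → Tm → Tm → Prop
  | 0 => Ibot
  | n + 1 => Tfun (Titer n)

/-- The least fixed point `I* = ⨆ₙ Tⁿ(I_⊥)` of `T`. -/
def Istar : ℕ → Tm → Tm → Prop := fun i p g => ∃ n, Titer n i p g

/-- An implication, viewed as a clause without quantifiers, lies in its own extension. -/
theorem mem_extD_impl (i : ℕ) (g a : Tm) : (a, g) ∈ extD i (Tm.impl g a) :=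
  ⟨[], g, a, [], rfl, .nil, rfl⟩

/-- On atomic formulas `T` adds one backchaining step. -/
theorem Tfun_of_isAtom (I : ℕ → Tm → Tm → Prop) (i : ℕ) (p : Tm) {a : Tm} (ha : a.isAtom) :
    Tfun I i p a ↔ I i p a ∨ ∃ q ∈ extD i p, q.1 = a ∧ I i p q.2 := by
  cases a <;> first | exact ha.elim | rfl

/-- If `G ⊃ A_r ⊑ₚ P` then `I*_i(P, G) ≤_Ω I*_i(P, A_r)`, where
`I* = ⨆ₙ Tⁿ(I_⊥)` is the least fixed point of `T` (over `Ω = {⊤,⊥}`, where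
`≤_Ω` is implication). -/
theorem Istar_clause (i : ℕ) (p g a : Tm)
    (ha : a.isAtom) (hr : a.rigid)
    (h : progLe (Tm.impl g a) p) :
    Istar i p g → Istar i p a := by
  rintro ⟨n, hn⟩
  exact ⟨n + 1, (Tfun_of_isAtom _ i p ha).2 (.inr ⟨(a, g), h i (mem_extD_impl i g a), rfl, hn⟩)⟩
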